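/- Suppose Ψ₁ : F₁ × F₁ → F₂ is an alternating P-bilinear map which is 1-compatible, and let Ψ₂ : F₁ × F₂ → F₃ be the unique P-bilinear map satisfying ψ₃(y₁, Ψ₂(x₁,x₂)) = ψ̄₄(Ψ₁(y₁,x₁), x₂) for all y₁, x₁ ∈ F₁ and x₂ ∈ F₂ (Ψ₂ exists and is unique because x₃ ↦ ψ₃(−,x₃) is an isomorphism). Then for all xᵢ, yᵢ, zᵢ ∈ Fᵢ: (1) d₃(Ψ₂(x₁,x₂)) = d₁(x₁)·x₂ − Ψ₁(x₁, d₂x₂); (2) d₄(ψ₃(x₁,x₃)) = d₁(x₁)·x₃ − Ψ₂(x₁, d₃x₃); (3) d₄(ψ̄₄(x₂,y₂)) = Ψ₂(d₂x₂, y₂) + Ψ₂(d₂y₂, x₂); (4) d₄(ψ₄(x₂)) = Ψ₂(d₂x₂, x₂); and (5) Ψ₂(z₁, Ψ₁(x₁,y₁)) = Ψ₂(x₁, Ψ₁(y₁,z₁)). Consequently F carries the structure of a DG-algebra with divided powers which exhibits Poincaré duality. -/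

import Mathlib

open QuadraticMap LinearMap Submodule Function

/-- A non-zerodivisor of the ring acts injectively on a free module of rank one. -/
theorem eq_zero_of_smul_eq_zero_of_equiv {P F : Type*} [CommRing P] [AddCommGroup F] [Module P F]
    (e : F ≃ₗ[P] P) {r : P} (hr : r ∈ nonZeroDivisors P) {a : F} (h : r • a = 0) : a = 0 := by
  have h' : r * e a = 0 := by simpa using congrArg e h
  exact e.map_eq_zero_iff.mp ((mul_left_mem_nonZeroDivisors_eq_zero_iff hr).mp h')

section Multiplication

variable {P F1 F2 F4 : Type*} [CommRing P] [AddCommGroup F1] [Module P F1]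
  [AddCommGroup F2] [Module P F2] [AddCommGroup F4] [Module P F4]
  {d1 : F1 →ₗ[P] P} {d2 : F2 →ₗ[P] F1} {ψ4 : QuadraticMap P F2 F4}
  {Ψ1 : F1 →ₗ[P] F1 →ₗ[P] F2}

/-- The polarized form of the compatibility of `Ψ1` with `ψ4`. -/
theorem polarBilin_compat_add
    (hΨ12 : ∀ x1 x2, polar ψ4 (Ψ1 x1 (d2 x2)) x2 = d1 x1 • ψ4 x2) (x1 : F1) (x2 y2 : F2) :
    polarBilin ψ4 (Ψ1 x1 (d2 x2)) y2 + polarBilin ψ4 (Ψ1 x1 (d2 y2)) x2 =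
      d1 x1 • polarBilin ψ4 x2 y2 := by
  have hB : ∀ x1 x2, polarBilin ψ4 (Ψ1 x1 (d2 x2)) x2 = d1 x1 • ψ4 x2 := hΨ12
  have h := hB x1 (x2 + y2)
  simp only [map_add, LinearMap.add_apply, hB] at h
  rw [polarBilin_apply_apply ψ4 x2 y2, QuadraticMap.polar, smul_sub, smul_sub, ← h]
  abel

/-- The four-fold form `(x, y, z, w) ↦ ψ̄₄(Ψ1 x y, Ψ1 z w)` vanishes if its first and third
arguments agree. -/
theorem polarBilin_mul_self_eq_zero (e : F4 ≃ₗ[P] P) {x0 : F1} (hx0 : d1 x0 ∈ nonZeroDivisors P)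
    (hΨ1alt : ∀ x1, Ψ1 x1 x1 = 0)
    (hΨ11 : ∀ x1 y1, d2 (Ψ1 x1 y1) = d1 x1 • y1 - d1 y1 • x1)
    (hΨ12 : ∀ x1 x2, polar ψ4 (Ψ1 x1 (d2 x2)) x2 = d1 x1 • ψ4 x2) (z x y : F1) :
    polarBilin ψ4 (Ψ1 z x) (Ψ1 z y) = 0 := by
  have comm : ∀ a b, polarBilin ψ4 a b = polarBilin ψ4 b a := fun a b => polar_comm ψ4 a b
  have boundary : ∀ z x2 y, polarBilin ψ4 (Ψ1 z (d2 x2)) (Ψ1 z y) = 0 := fun z x2 y => by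
    have h := polarBilin_compat_add hΨ12 z x2 (Ψ1 z y)
    rw [hΨ11, map_sub, map_smul, map_smul, hΨ1alt, smul_zero, sub_zero, map_smul,
      LinearMap.smul_apply, comm (Ψ1 z y) x2] at h
    simpa using h
  have expand : ∀ x, d1 x0 • x = d2 (Ψ1 x0 x) + d1 x • x0 := fun x => by rw [hΨ11]; abel
  have reduce : ∀ z x y, d1 x0 • polarBilin ψ4 (Ψ1 z x) (Ψ1 z y) =
      d1 x • polarBilin ψ4 (Ψ1 z x0) (Ψ1 z y) := fun z x y => by
    rw [← LinearMap.smul_apply, ← map_smul, ← map_smul, expand, map_add, map_add,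
      LinearMap.add_apply, boundary, zero_add, map_smul, map_smul, LinearMap.smul_apply]
  have base : ψ4 (Ψ1 x0 z) = 0 := by
    refine eq_zero_of_smul_eq_zero_of_equiv e hx0 ?_
    have h := hΨ12 x0 (Ψ1 x0 z)
    rwa [← polarBilin_apply_apply, boundary, eq_comm] at h
  have skew : Ψ1 z x0 = -Ψ1 x0 z := (IsAlt.neg hΨ1alt x0 z).symm
  refine eq_zero_of_smul_eq_zero_of_equiv e hx0 (eq_zero_of_smul_eq_zero_of_equiv e hx0 ?_)
  rw [reduce, smul_comm, comm, reduce, skew, polarBilin_apply_apply, polar_self,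
    QuadraticMap.map_neg, base]
  simp

end Multiplication

theorem stmt_3
    (P : Type*) [CommRing P] [IsNoetherianRing P]
    (F1 F2 F3 F4 : Type*)
    [AddCommGroup F1] [Module P F1] [Module.Free P F1] [Module.Finite P F1]
    [AddCommGroup F2] [Module P F2] [Module.Free P F2] [Module.Finite P F2]
    [AddCommGroup F3] [Module P F3] [Module.Free P F3] [Module.Finite P F3]
    [AddCommGroup F4] [Module P F4] [Module.Free P F4] [Module.Finite P F4]
    (d1 : F1 →ₗ[P] P) (d2 : F2 →ₗ[P] F1) (d3 : F3 →ₗ[P] F2) (d4 : F4 →ₗ[P] F3)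
    (hd21 : ∀ x2, d1 (d2 x2) = 0) (hd32 : ∀ x3, d2 (d3 x3) = 0)
    (hd43 : ∀ x4, d3 (d4 x4) = 0)
    (hinj4 : Function.Injective d4)
    (hex3 : LinearMap.range d4 = LinearMap.ker d3)
    (hex2 : LinearMap.range d3 = LinearMap.ker d2)
    (hex1 : LinearMap.range d2 = LinearMap.ker d1)
    (hrank : Nonempty (F4 ≃ₗ[P] P))
    (ψ3 : F1 →ₗ[P] F3 →ₗ[P] F4) (ψ4 : QuadraticMap P F2 F4)
    (hA2 : ∀ x1 x4, ψ3 x1 (d4 x4) = d1 x1 • x4)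
    (hA3 : ∀ x2 x3, polar ψ4 x2 (d3 x3) = - ψ3 (d2 x2) x3)
    (hiso1 : Function.Bijective ψ3)
    (hiso2 : Function.Bijective (polarBilin ψ4))
    (hiso3 : Function.Bijective ψ3.flip)
    (hreg : ∃ x1, d1 x1 ∈ nonZeroDivisors P)
    (Ψ1 : F1 →ₗ[P] F1 →ₗ[P] F2) (hΨ1alt : ∀ x1, Ψ1 x1 x1 = 0)
    (hΨ11 : ∀ x1 y1, d2 (Ψ1 x1 y1) = d1 x1 • y1 - d1 y1 • x1)
    (hΨ12 : ∀ x1 x2, polar ψ4 (Ψ1 x1 (d2 x2)) x2 = d1 x1 • ψ4 x2)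
    (Ψ2 : F1 →ₗ[P] F2 →ₗ[P] F3)
    (hΨ2 : ∀ y1 x1 x2, ψ3 y1 (Ψ2 x1 x2) = polar ψ4 (Ψ1 y1 x1) x2)
    : (∀ x1 x2, d3 (Ψ2 x1 x2) = d1 x1 • x2 - Ψ1 x1 (d2 x2)) ∧
      (∀ x1 x3, d4 (ψ3 x1 x3) = d1 x1 • x3 - Ψ2 x1 (d3 x3)) ∧
      (∀ x2 y2, d4 (polar ψ4 x2 y2) = Ψ2 (d2 x2) y2 + Ψ2 (d2 y2) x2) ∧
      (∀ x2, d4 (ψ4 x2) = Ψ2 (d2 x2) x2) ∧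
      (∀ x1 y1 z1, Ψ2 z1 (Ψ1 x1 y1) = Ψ2 x1 (Ψ1 y1 z1)) := by
  obtain ⟨e⟩ := hrank
  obtain ⟨x0, hx0⟩ := hreg
  have comm : ∀ a b, polarBilin ψ4 a b = polarBilin ψ4 b a := fun a b => polar_comm ψ4 a b
  have skew : ∀ a b, Ψ1 a b = -Ψ1 b a := fun a b => (IsAlt.neg hΨ1alt b a).symm
  have ext2 : ∀ {a b : F2}, (∀ y, polarBilin ψ4 y a = polarBilin ψ4 y b) → a = b :=
    fun h => hiso2.1 (LinearMap.ext fun y => by rw [comm, h, comm])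
  have ext3 : ∀ {a b : F3}, (∀ y, ψ3 y a = ψ3 y b) → a = b :=
    fun h => hiso3.1 (LinearMap.ext h)
  have hB3 : ∀ x2 x3, polarBilin ψ4 x2 (d3 x3) = -ψ3 (d2 x2) x3 := hA3
  have hBΨ : ∀ y1 x1 x2, ψ3 y1 (Ψ2 x1 x2) = polarBilin ψ4 (Ψ1 y1 x1) x2 := hΨ2
  have compat := polarBilin_compat_add hΨ12
  refine ⟨fun x1 x2 => ext2 fun y2 => ?_, fun x1 x3 => ext3 fun y1 => ?_,
    fun x2 y2 => ext3 fun y1 => ?_, fun x2 => ext3 fun y1 => ?_,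
    fun x y z => ext3 fun w => ?_⟩
  · rw [hB3, hBΨ, skew, map_neg, LinearMap.neg_apply, neg_neg, map_sub, map_smul, comm y2 x2,
      ← compat x1 x2 y2, comm y2]
    abel
  · rw [hA2, map_sub, map_smul, hBΨ, hB3, hΨ11]
    simp
  · rw [hA2, map_add, hBΨ, hBΨ, compat, polarBilin_apply_apply]
  · rw [hA2, hBΨ, polarBilin_apply_apply, hΨ12]
  · have swap : ∀ a b c d, polarBilin ψ4 (Ψ1 a b) (Ψ1 c d) + polarBilin ψ4 (Ψ1 c b) (Ψ1 a d) = 0 :=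
      fun a b c d => by
        have alt := polarBilin_mul_self_eq_zero e hx0 hΨ1alt hΨ11 hΨ12
        have h := alt (a + c) b d
        simpa only [map_add, LinearMap.add_apply, alt, zero_add, add_zero, add_comm] using h
    have h := swap z w x y
    rw [skew z w, skew x w, skew z y] at h
    simp only [map_neg, LinearMap.neg_apply, neg_neg] at h
    rw [hBΨ, hBΨ]
    exact neg_add_eq_zero.mp h
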